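/- Let K be a positive integer and let (a_N)_{N≥1} be a sequence of positive real numbers with a_N → 0 as N → ∞. Then there exist a constant C > 0 and N₀ ∈ ℕ such that for all N ≥ N₀, |∫_{SO(2N+1)} (Λ_X'(e^{-a_N/N})/Λ_X(e^{-a_N/N}))^K dHaar(X) − (−1)^K [ (N/a_N)^K − K·N^K/a_N^{K−1} ]| ≤ C ( N^{K−1}/a_N^{K−1} + N^K/a_N^{K−2} ). -/

import Mathlib

open MeasureTheory Real Filter Matrix

noncomputable section

instance matrixMeasurableSpace {m n α : Type*} [MeasurableSpace α] :
    MeasurableSpace (Matrix m n α) :=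
  (inferInstance : MeasurableSpace (m → n → α))

/-- The special orthogonal group `SO(n)`, realised as the subgroup of the orthogonal group
`O(n)` consisting of matrices of determinant one. -/
def SOsub (n : ℕ) : Subgroup (Matrix.orthogonalGroup (Fin n) ℝ) where
  carrier := {X | (X : Matrix (Fin n) (Fin n) ℝ).det = 1}
  one_mem' := by simp
  mul_mem' := by
    intro a b ha hb
    simp only [Set.mem_setOf_eq] at *
    simp [Matrix.det_mul, ha, hb]
  inv_mem' := by
    intro a ha
    simp only [Set.mem_setOf_eq] at *
    have h : ((a⁻¹ * a : Matrix.orthogonalGroup (Fin n) ℝ) : Matrix (Fin n) (Fin n) ℝ) = 1 := by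
      simp
    have := congrArg Matrix.det h
    simp only [MulMemClass.coe_mul, Matrix.det_mul, ha, mul_one, Matrix.det_one] at this
    exact this

/-- The group `SO(2N+1)`. -/
abbrev SOodd (N : ℕ) := ↥(SOsub (2 * N + 1))

/-- The matrix underlying an element of `SO(2N+1)`. -/
def mat {N : ℕ} (X : SOodd N) : Matrix (Fin (2 * N + 1)) (Fin (2 * N + 1)) ℝ :=
  ((X : Matrix.orthogonalGroup (Fin (2 * N + 1)) ℝ) : Matrix (Fin (2 * N + 1)) (Fin (2 * N + 1)) ℝ)

/-- The characteristic polynomial `Λ_X(s) = det(I - s Xᵀ)` of `X ∈ SO(2N+1)`. -/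
def charPoly {N : ℕ} (X : SOodd N) (s : ℝ) : ℝ :=
  (1 - s • (mat X)ᵀ).det

section Resolvent

variable {n : Type*} [Fintype n]

lemma dotProduct_self_nonneg (u : n → ℝ) : 0 ≤ u ⬝ᵥ u :=
  Finset.sum_nonneg fun i _ => mul_self_nonneg (u i)

lemma trace_transpose_mul_self (M : Matrix n n ℝ) :
    (Mᵀ * M).trace = ∑ j, M.col j ⬝ᵥ M.col j := by
  simp [Matrix.trace, Matrix.mul_apply, dotProduct]

lemma trace_transpose_mul_self_nonneg (M : Matrix n n ℝ) : 0 ≤ (Mᵀ * M).trace := by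
  rw [trace_transpose_mul_self]
  exact Finset.sum_nonneg fun j _ => dotProduct_self_nonneg _

variable [DecidableEq n]

/-- The resolvent `(1 - s X)⁻¹`. -/
def invOneSub (s : ℝ) (X : Matrix n n ℝ) : Matrix n n ℝ := (1 - s • X)⁻¹

lemma dotProduct_self_mulVec {X : Matrix n n ℝ} (hX : Xᵀ * X = 1) (u : n → ℝ) :
    X *ᵥ u ⬝ᵥ X *ᵥ u = u ⬝ᵥ u := by
  rw [Matrix.dotProduct_mulVec, Matrix.vecMul_mulVec, hX, Matrix.vecMul_one]

lemma sq_mul_dotProduct_le_one_sub_smul {X : Matrix n n ℝ} (hX : Xᵀ * X = 1) {s : ℝ} (hs : 0 ≤ s)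
    (u : n → ℝ) :
    (1 - s) ^ 2 * (u ⬝ᵥ u) ≤ ((1 - s • X) *ᵥ u) ⬝ᵥ ((1 - s • X) *ᵥ u) := by
  have h1 := dotProduct_self_mulVec hX u
  have h2 : 0 ≤ (u - X *ᵥ u) ⬝ᵥ (u - X *ᵥ u) := by
    exact dotProduct_self_nonneg _
  have h3 : (X *ᵥ u) ⬝ᵥ u = u ⬝ᵥ (X *ᵥ u) := dotProduct_comm _ _
  simp only [sub_dotProduct, dotProduct_sub, Matrix.sub_mulVec, Matrix.one_mulVec,
    Matrix.smul_mulVec, smul_dotProduct, dotProduct_smul, smul_eq_mul, h1, h3] at h2 ⊢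
  nlinarith

lemma isUnit_one_sub_smul {X : Matrix n n ℝ} (hX : Xᵀ * X = 1) {s : ℝ} (hs : 0 ≤ s)
    (hs1 : s < 1) : IsUnit (1 - s • X).det := by
  rw [isUnit_iff_ne_zero]
  intro h
  obtain ⟨v, hv, hv0⟩ := Matrix.exists_mulVec_eq_zero_iff.mpr h
  have h1 := sq_mul_dotProduct_le_one_sub_smul hX hs v
  rw [hv0, zero_dotProduct] at h1
  have h2 : 0 ≤ v ⬝ᵥ v := by exact dotProduct_self_nonneg _
  have h3 : v ⬝ᵥ v ≠ 0 := by simpa using hv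
  have h4 : 0 < (1 - s) ^ 2 := by nlinarith
  have : 0 < v ⬝ᵥ v := lt_of_le_of_ne h2 h3.symm
  nlinarith [mul_pos h4 this]

lemma invOneSub_mul {X : Matrix n n ℝ} (hX : Xᵀ * X = 1) {s : ℝ} (hs : 0 ≤ s) (hs1 : s < 1) :
    invOneSub s X * (1 - s • X) = 1 :=
  Matrix.nonsing_inv_mul _ (isUnit_one_sub_smul hX hs hs1)

lemma mul_invOneSub {X : Matrix n n ℝ} (hX : Xᵀ * X = 1) {s : ℝ} (hs : 0 ≤ s) (hs1 : s < 1) :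
    (1 - s • X) * invOneSub s X = 1 :=
  Matrix.mul_nonsing_inv _ (isUnit_one_sub_smul hX hs hs1)

lemma invOneSub_transpose (s : ℝ) (X : Matrix n n ℝ) : invOneSub s Xᵀ = (invOneSub s X)ᵀ := by
  simp [invOneSub, Matrix.transpose_nonsing_inv]

lemma smul_mul_invOneSub {X : Matrix n n ℝ} (hX : Xᵀ * X = 1) {s : ℝ} (hs : 0 ≤ s)
    (hs1 : s < 1) : s • (X * invOneSub s X) = invOneSub s X - 1 := by
  have := mul_invOneSub hX hs hs1
  rw [sub_mul, one_mul, smul_mul_assoc] at this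
  rw [← this]; abel

lemma dotProduct_invOneSub_le {X : Matrix n n ℝ} (hX : Xᵀ * X = 1) {s : ℝ} (hs : 0 ≤ s)
    (hs1 : s < 1) (u : n → ℝ) :
    (1 - s) ^ 2 * ((invOneSub s X *ᵥ u) ⬝ᵥ (invOneSub s X *ᵥ u)) ≤ u ⬝ᵥ u := by
  have := sq_mul_dotProduct_le_one_sub_smul hX hs (invOneSub s X *ᵥ u)
  rwa [Matrix.mulVec_mulVec, mul_invOneSub hX hs hs1, Matrix.one_mulVec] at this

lemma invOneSub_commute_transpose {X : Matrix n n ℝ} (hX : Xᵀ * X = 1) (hX' : X * Xᵀ = 1) (s : ℝ) :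
    invOneSub s X * (invOneSub s X)ᵀ = (invOneSub s X)ᵀ * invOneSub s X := by
  rw [← invOneSub_transpose, invOneSub, invOneSub, ← Matrix.mul_inv_rev, ← Matrix.mul_inv_rev]
  congr 1
  simp only [sub_mul, mul_sub, one_mul, mul_one, smul_mul_assoc, mul_smul_comm, hX, hX']
  module

lemma invOneSub_add_transpose {X : Matrix n n ℝ} (hX : Xᵀ * X = 1) (hX' : X * Xᵀ = 1) {s : ℝ}
    (hs : 0 ≤ s) (hs1 : s < 1) :
    invOneSub s X + (invOneSub s X)ᵀ =
      1 + (1 - s ^ 2) • (invOneSub s X * (invOneSub s X)ᵀ) := by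
  have e1 := invOneSub_mul hX hs hs1
  have hY : Xᵀᵀ * Xᵀ = 1 := by simpa using hX'
  have e2 := mul_invOneSub hY hs hs1
  rw [invOneSub_transpose] at e2
  set Q := invOneSub s X
  have key : (1 - s • Xᵀ) + (1 - s • X) =
      (1 - s • X) * (1 - s • Xᵀ) + (1 - s ^ 2) • (1 : Matrix n n ℝ) := by
    simp only [sub_mul, mul_sub, one_mul, mul_one, smul_mul_assoc, mul_smul_comm, hX']
    module
  have h := congrArg (fun M => Q * M * Qᵀ) key
  simp only [mul_add, add_mul, mul_assoc, e2, mul_one] at h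
  simp only [← mul_assoc, e1, one_mul, mul_smul_comm, smul_mul_assoc] at h
  exact h

/-- The trace of the resolvent at an orthogonal matrix, after removing the constant part and the
contribution of one eigenvalue `1`; it equals `∑ⱼ (1 - s²) / |1 - s exp (iθⱼ)|²` over the
eigenangles `θⱼ ∈ [0, π]` other than the forced one. -/
def excess (s : ℝ) (X : Matrix n n ℝ) : ℝ :=
  (invOneSub s X).trace - Fintype.card n / 2 - (1 + s) / (2 * (1 - s))

lemma two_mul_excess {X : Matrix n n ℝ} (hX : Xᵀ * X = 1) (hX' : X * Xᵀ = 1) {s : ℝ}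
    (hs : 0 ≤ s) (hs1 : s < 1) :
    2 * excess s X =
      (1 - s ^ 2) * ((invOneSub s X * (invOneSub s X)ᵀ).trace - 1 / (1 - s) ^ 2) := by
  have h := congrArg Matrix.trace (invOneSub_add_transpose hX hX' hs hs1)
  simp only [Matrix.trace_add, Matrix.trace_transpose, Matrix.trace_one, Matrix.trace_smul,
    smul_eq_mul] at h
  have hd : (1 - s) ≠ 0 := by linarith
  have e : (1 - s ^ 2) * (1 / (1 - s) ^ 2) = (1 + s) / (1 - s) := by field_simp; ring
  have e' : 2 * ((1 + s) / (2 * (1 - s))) = (1 + s) / (1 - s) := by field_simp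
  rw [excess, mul_sub (1 - s ^ 2), e]
  linarith

lemma invOneSub_mulVec_of_fixed {X : Matrix n n ℝ} (hX : Xᵀ * X = 1) {s : ℝ} (hs : 0 ≤ s)
    (hs1 : s < 1) {v : n → ℝ} (hv : X *ᵥ v = v) : invOneSub s X *ᵥ v = (1 - s)⁻¹ • v := by
  have h : (1 - s • X) *ᵥ v = (1 - s) • v := by
    rw [Matrix.sub_mulVec, Matrix.one_mulVec, Matrix.smul_mulVec, hv]; module
  have h2 : invOneSub s X *ᵥ ((1 - s) • v) = v := by
    rw [← h, Matrix.mulVec_mulVec, invOneSub_mul hX hs hs1, Matrix.one_mulVec]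
  have hd : (1 - s) ≠ 0 := by linarith
  calc invOneSub s X *ᵥ v = (1 - s)⁻¹ • (invOneSub s X *ᵥ ((1 - s) • v)) := by
        rw [Matrix.mulVec_smul, smul_smul, inv_mul_cancel₀ hd, one_smul]
    _ = _ := by rw [h2]

lemma trace_deflated {X : Matrix n n ℝ} (hX : Xᵀ * X = 1) {s : ℝ} (hs : 0 ≤ s)
    (hs1 : s < 1) {v : n → ℝ} (hv : X *ᵥ v = v) (hv1 : v ⬝ᵥ v = 1) :
    ((invOneSub s X - (1 - s)⁻¹ • Matrix.vecMulVec v v)ᵀ *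
      (invOneSub s X - (1 - s)⁻¹ • Matrix.vecMulVec v v)).trace =
      (invOneSub s X * (invOneSub s X)ᵀ).trace - 1 / (1 - s) ^ 2 := by
  have hq := invOneSub_mulVec_of_fixed hX hs hs1 hv
  set Q := invOneSub s X
  have e1 : Qᵀ * Matrix.vecMulVec v v = (Matrix.vecMulVec v v * Q)ᵀ := by
    rw [Matrix.transpose_mul, Matrix.transpose_vecMulVec]
  have e2 : (Matrix.vecMulVec v v * Q).trace = (1 - s)⁻¹ := by
    rw [Matrix.trace_mul_comm, Matrix.mul_vecMulVec, hq, Matrix.trace_vecMulVec, smul_dotProduct,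
      hv1, smul_eq_mul, mul_one]
  have e3 : (Matrix.vecMulVec v v * Matrix.vecMulVec v v).trace = 1 := by
    rw [Matrix.vecMulVec_mul_vecMulVec, Matrix.trace_vecMulVec, hv1, one_smul, hv1]
  rw [Matrix.transpose_sub, Matrix.transpose_smul, Matrix.transpose_vecMulVec]
  simp only [sub_mul, mul_sub, smul_mul_assoc, mul_smul_comm, Matrix.trace_sub, Matrix.trace_smul,
    e1, e2, e3, Matrix.trace_transpose, smul_eq_mul]
  rw [Matrix.trace_mul_comm]
  have hd : (1 - s) ≠ 0 := by linarith
  field_simp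
  ring

lemma excess_nonneg {X : Matrix n n ℝ} (hX : Xᵀ * X = 1) (hX' : X * Xᵀ = 1) {s : ℝ} (hs : 0 ≤ s)
    (hs1 : s < 1) {v : n → ℝ} (hv : X *ᵥ v = v) (hv1 : v ⬝ᵥ v = 1) : 0 ≤ excess s X := by
  have h1 := two_mul_excess hX hX' hs hs1
  rw [← trace_deflated hX hs hs1 hv hv1] at h1
  have h2 : 0 ≤ 1 - s ^ 2 := by nlinarith
  have := mul_nonneg h2 (trace_transpose_mul_self_nonneg
    (invOneSub s X - (1 - s)⁻¹ • Matrix.vecMulVec v v))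
  linarith

lemma trace_loop_eq {X : Matrix n n ℝ} (hX : Xᵀ * X = 1) (hX' : X * Xᵀ = 1) {s : ℝ} (hs : 0 ≤ s)
    (hs1 : s < 1) :
    (invOneSub s X * (invOneSub s X - 1)ᵀ).trace -
        (invOneSub s X).trace * (invOneSub s X - 1).trace =
      (((Fintype.card n : ℝ) - 1) / 2) ^ 2 - excess s X ^ 2
        - excess s X * (2 * s / (1 - s ^ 2)) := by
  have h1 := two_mul_excess hX hX' hs hs1
  have h2 : (invOneSub s X).trace =
    excess s X + Fintype.card n / 2 + (1 + s) / (2 * (1 - s)) := by rw [excess]; ring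
  have hd : (1 - s) ≠ 0 := by linarith
  have hd2 : (1 + s) ≠ 0 := by linarith
  have hd3 : (1 - s ^ 2) ≠ 0 := by nlinarith
  have h3 : (invOneSub s X * (invOneSub s X)ᵀ).trace =
      2 * excess s X / (1 - s ^ 2) + 1 / (1 - s) ^ 2 := by
    rw [h1]; field_simp; ring
  rw [Matrix.transpose_sub, mul_sub, Matrix.transpose_one, mul_one, Matrix.trace_sub,
    Matrix.trace_sub, Matrix.trace_one, h3, h2]
  have : (1 - s ^ 2) = (1 - s) * (1 + s) := by ring
  rw [this]
  field_simp
  ring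

lemma trace_cubic_eq {X : Matrix n n ℝ} (hX : Xᵀ * X = 1) (hX' : X * Xᵀ = 1) {s : ℝ} (hs : 0 ≤ s)
    (hs1 : s < 1) :
    ((invOneSub s X)ᵀ * (invOneSub s X * invOneSub s X - invOneSub s X)).trace -
        (invOneSub s X * (invOneSub s X * invOneSub s X - invOneSub s X)).trace =
      (1 - s ^ 2) / 2 * ((((invOneSub s X - (invOneSub s X)ᵀ) * invOneSub s X)ᵀ) *
        ((invOneSub s X - (invOneSub s X)ᵀ) * invOneSub s X)).trace := by
  have hc := invOneSub_commute_transpose hX hX' s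
  have ha := invOneSub_add_transpose hX hX' hs hs1
  set Q := invOneSub s X
  set B := Q - Qᵀ with hB
  have hBt : Bᵀ = -B := by simp [hB]
  have e1 : (Qᵀ * (Q * Q - Q)).trace - (Q * (Q * Q - Q)).trace = -(B * (Q * Q - Q)).trace := by
    rw [hB, sub_mul, Matrix.trace_sub]; ring
  have e2 : (B * (Q * Q - Q)).trace = -(B * (Qᵀ * Qᵀ - Qᵀ)).trace := by
    rw [← Matrix.trace_transpose, Matrix.transpose_mul, hBt, Matrix.transpose_sub,
      Matrix.transpose_mul, mul_neg, Matrix.trace_neg, Matrix.trace_mul_comm]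
  have e3 : (Q * Q - Q) - (Qᵀ * Qᵀ - Qᵀ) = (1 - s ^ 2) • (B * (Q * Qᵀ)) := by
    have : B * (Q + Qᵀ) = B + (1 - s ^ 2) • (B * (Q * Qᵀ)) := by
      rw [ha, mul_add, mul_one, mul_smul_comm]
    rw [← sub_eq_iff_eq_add'] at this
    rw [← this, hB]
    simp only [sub_mul, mul_add, hc]
    abel
  have e4 : 2 * (B * (Q * Q - Q)).trace = (1 - s ^ 2) * (B * (B * (Q * Qᵀ))).trace := by
    have := congrArg (fun M => (B * M).trace) e3
    simp only [mul_sub B (Q * Q - Q), Matrix.trace_sub, mul_smul_comm, Matrix.trace_smul,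
      smul_eq_mul] at this
    linarith
  have e5 : (B * (B * (Q * Qᵀ))).trace = -((B * Q)ᵀ * (B * Q)).trace := by
    rw [Matrix.trace_mul_comm B, Matrix.transpose_mul, hBt, mul_neg, neg_mul, Matrix.trace_neg,
      neg_neg, Matrix.trace_mul_comm (Qᵀ * B)]
    simp only [mul_assoc]
  rw [e1]
  rw [e5] at e4
  linarith

lemma trace_cubic_le {X : Matrix n n ℝ} (hX : Xᵀ * X = 1) (hX' : X * Xᵀ = 1) {s : ℝ} (hs : 0 ≤ s)
    (hs1 : s < 1) {v : n → ℝ} (hv : X *ᵥ v = v) (hv1 : v ⬝ᵥ v = 1) :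
    ((invOneSub s X)ᵀ * (invOneSub s X * invOneSub s X - invOneSub s X)).trace -
        (invOneSub s X * (invOneSub s X * invOneSub s X - invOneSub s X)).trace ≤
      4 / (1 - s) ^ 2 * excess s X := by
  rw [trace_cubic_eq hX hX' hs hs1]
  have hY : Xᵀᵀ * Xᵀ = 1 := by simpa using hX'
  have hvt : Xᵀ *ᵥ v = v := by
    conv_lhs => rw [← hv]
    rw [Matrix.mulVec_mulVec, hX, Matrix.one_mulVec]
  have hq := invOneSub_mulVec_of_fixed hX hs hs1 hv
  have hqt := invOneSub_mulVec_of_fixed hY hs hs1 hvt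
  have hT := two_mul_excess hX hX' hs hs1
  rw [← trace_deflated hX hs hs1 hv hv1] at hT
  have hb1 := dotProduct_invOneSub_le hX hs hs1
  have hb2 := dotProduct_invOneSub_le hY hs hs1
  rw [invOneSub_transpose] at hb2 hqt
  set Q := invOneSub s X
  set M := Q - (1 - s)⁻¹ • Matrix.vecMulVec v v with hM
  have hBv : (Q - Qᵀ) *ᵥ v = 0 := by rw [Matrix.sub_mulVec, hq, hqt, sub_self]
  have hBM : (Q - Qᵀ) * Q = (Q - Qᵀ) * M := by
    rw [hM, mul_sub, mul_smul_comm, Matrix.mul_vecMulVec, hBv]; simp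
  have hd : 0 < (1 - s) ^ 2 := by have : 0 < 1 - s := by linarith
                                  positivity
  have hcol : ∀ u : n → ℝ, (1 - s) ^ 2 * ((Q - Qᵀ) *ᵥ u ⬝ᵥ (Q - Qᵀ) *ᵥ u) ≤ 4 * (u ⬝ᵥ u) := by
    intro u
    have h1 := hb1 u
    have h2 := hb2 u
    have h3 := dotProduct_self_nonneg (Q *ᵥ u + Qᵀ *ᵥ u)
    have h4 : (Qᵀ *ᵥ u) ⬝ᵥ (Q *ᵥ u) = (Q *ᵥ u) ⬝ᵥ (Qᵀ *ᵥ u) := dotProduct_comm _ _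
    rw [Matrix.sub_mulVec]
    simp only [sub_dotProduct, dotProduct_sub, add_dotProduct, dotProduct_add, h4] at h3 ⊢
    nlinarith
  have hsum : (1 - s) ^ 2 * (((Q - Qᵀ) * M)ᵀ * ((Q - Qᵀ) * M)).trace ≤ 4 * (Mᵀ * M).trace := by
    rw [trace_transpose_mul_self, trace_transpose_mul_self, Finset.mul_sum, Finset.mul_sum]
    exact Finset.sum_le_sum fun j _ => hcol (M.col j)
  rw [hBM, div_mul_eq_mul_div 4, le_div_iff₀ hd]
  have hs2 : 0 ≤ 1 - s ^ 2 := by nlinarith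
  nlinarith [mul_le_mul_of_nonneg_left hsum hs2]

end Resolvent

section Generators

variable {n : Type*} [DecidableEq n]

/-- The generator of rotations in the coordinate plane spanned by `i` and `j`. -/
def skewGen (i j : n) : Matrix n n ℝ := Matrix.single i j 1 - Matrix.single j i 1

lemma skewGen_transpose (i j : n) : (skewGen i j)ᵀ = -skewGen i j := by
  simp [skewGen, Matrix.transpose_single]

variable [Fintype n]

lemma trace_skewGen_mul (i j : n) (M : Matrix n n ℝ) :
    (skewGen i j * M).trace = M j i - M i j := by
  simp [skewGen, sub_mul, Matrix.trace_sub, Matrix.trace_single_mul]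

lemma mul_skewGen_mul_apply (i j k l : n) (M N : Matrix n n ℝ) :
    (M * skewGen i j * N) k l = M k i * N j l - M k j * N i l := by
  simp [skewGen, mul_sub, sub_mul, Matrix.mul_apply, Matrix.single_apply, ite_and]

lemma sum_trace_skewGen_mul_mul (M N : Matrix n n ℝ) :
    ∑ i, ∑ j, (skewGen i j * (M * skewGen i j * N)).trace =
      2 * ((M * Nᵀ).trace - M.trace * N.trace) := by
  have h : ∀ i j, (skewGen i j * (M * skewGen i j * N)).trace =
      M j i * N j i + M i j * N i j - (M j j * N i i + M i i * N j j) := by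
    intro i j
    rw [trace_skewGen_mul, mul_skewGen_mul_apply, mul_skewGen_mul_apply]; ring
  simp only [h, Finset.sum_sub_distrib, Finset.sum_add_distrib]
  have e1 : ∑ i, ∑ j, M i j * N i j = (M * Nᵀ).trace := by
    simp [Matrix.trace, Matrix.mul_apply]
  have e2 : ∑ i, ∑ j, M j i * N j i = (M * Nᵀ).trace := by
    rw [Finset.sum_comm, e1]
  have e3 : ∑ i, ∑ j, M i i * N j j = M.trace * N.trace := by
    simp [Matrix.trace, Finset.sum_mul_sum]
  have e4 : ∑ i, ∑ j, M j j * N i i = M.trace * N.trace := by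
    rw [Finset.sum_comm, e3]
  rw [e1, e2, e3, e4]; ring

lemma sum_trace_skewGen_mul_trace (M N : Matrix n n ℝ) :
    ∑ i, ∑ j, (skewGen i j * M).trace * (skewGen i j * N).trace =
      2 * ((Mᵀ * N).trace - (M * N).trace) := by
  have h : ∀ i j, (skewGen i j * M).trace * (skewGen i j * N).trace =
      M j i * N j i + M i j * N i j - (M j i * N i j + M i j * N j i) := by
    intro i j
    rw [trace_skewGen_mul, trace_skewGen_mul]; ring
  simp only [h, Finset.sum_sub_distrib, Finset.sum_add_distrib]
  have e1 : ∑ i, ∑ j, M j i * N j i = (Mᵀ * N).trace := by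
    simp [Matrix.trace, Matrix.mul_apply]
  have e2 : ∑ i, ∑ j, M i j * N i j = (Mᵀ * N).trace := by
    rw [Finset.sum_comm, e1]
  have e3 : ∑ i, ∑ j, M i j * N j i = (M * N).trace := by
    simp [Matrix.trace, Matrix.mul_apply]
  have e4 : ∑ i, ∑ j, M j i * N i j = (M * N).trace := by
    rw [Finset.sum_comm, e3]
  rw [e1, e2, e3, e4]; ring

end Generators

section Derivative

variable {n : Type*} [Fintype n] [DecidableEq n]

attribute [local instance] Matrix.linftyOpNormedRing Matrix.linftyOpNormedAlgebra

lemma hasDerivAt_exp_smul_mul (A X : Matrix n n ℝ) :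
    HasDerivAt (fun t : ℝ => NormedSpace.exp (t • A) * X) (A * X) 0 := by
  have h := (hasDerivAt_exp_smul_const' (𝕂 := ℝ) A (0 : ℝ)).mul_const X
  simp only [zero_smul, NormedSpace.exp_zero, mul_one] at h
  exact h

lemma hasDerivAt_invOneSub_exp {X : Matrix n n ℝ} (hX : Xᵀ * X = 1) {s : ℝ} (hs : 0 ≤ s)
    (hs1 : s < 1) (A : Matrix n n ℝ) :
    HasDerivAt (fun t : ℝ => invOneSub s (NormedSpace.exp (t • A) * X))
      (invOneSub s X * A * (invOneSub s X - 1)) 0 := by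
  have hu : IsUnit (1 - s • X) := (Matrix.isUnit_iff_isUnit_det _).mpr (isUnit_one_sub_smul hX hs hs1)
  obtain ⟨u, hu⟩ := hu
  have h1 : HasDerivAt (fun t : ℝ => 1 - s • (NormedSpace.exp (t • A) * X)) (-(s • (A * X))) 0 :=
    ((hasDerivAt_exp_smul_mul A X).const_smul s).const_sub 1
  have h2 := hasFDerivAt_ringInverse (𝕜 := ℝ) u
  have e : (u : Matrix n n ℝ) = 1 - s • (NormedSpace.exp ((0 : ℝ) • A) * X) := by simp [hu]
  rw [e] at h2
  have h3 := h2.comp_hasDerivAt (0 : ℝ) h1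
  have hinv : (↑u⁻¹ : Matrix n n ℝ) = invOneSub s X := by
    rw [invOneSub, Matrix.nonsing_inv_eq_ringInverse, ← hu, Ring.inverse_unit]
  simp only [hinv] at h3
  have e2 : invOneSub s X * A * (invOneSub s X - 1) =
      (-((ContinuousLinearMap.mulLeftRight ℝ (Matrix n n ℝ)) (invOneSub s X)) (invOneSub s X))
        (-(s • (A * X))) := by
    rw [← smul_mul_invOneSub hX hs hs1]
    simp [mul_assoc]
  have e3 : (fun t : ℝ => invOneSub s (NormedSpace.exp (t • A) * X)) =
      Ring.inverse ∘ fun t : ℝ => 1 - s • (NormedSpace.exp (t • A) * X) := by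
    funext t
    simp [invOneSub, Matrix.nonsing_inv_eq_ringInverse]
  rw [e2, e3]
  exact h3

lemma HasDerivAt.matrix_trace_mul (A : Matrix n n ℝ) {f : ℝ → Matrix n n ℝ} {f' : Matrix n n ℝ}
    {x : ℝ} (h : HasDerivAt f f' x) : HasDerivAt (fun t => (A * f t).trace) (A * f').trace x :=
  ((Matrix.traceLinearMap n ℝ ℝ ∘ₗ LinearMap.mulLeft ℝ A).toContinuousLinearMap.hasFDerivAt
    ).comp_hasDerivAt x h

lemma HasDerivAt.matrix_trace {f : ℝ → Matrix n n ℝ} {f' : Matrix n n ℝ} {x : ℝ}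
    (h : HasDerivAt f f' x) : HasDerivAt (fun t => (f t).trace) f'.trace x := by
  simpa using h.matrix_trace_mul 1

end Derivative

section Group

variable {N : ℕ}

lemma mat_mul_transpose (X : SOodd N) : mat X * (mat X)ᵀ = 1 := by
  simpa [mat, Matrix.star_eq_conjTranspose] using (Matrix.mem_orthogonalGroup_iff _ _).mp X.1.2

lemma transpose_mul_mat (X : SOodd N) : (mat X)ᵀ * mat X = 1 := by
  simpa [mat, Matrix.star_eq_conjTranspose] using (Matrix.mem_orthogonalGroup_iff' _ _).mp X.1.2

lemma det_mat (X : SOodd N) : (mat X).det = 1 := X.2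

/-- An orthogonal matrix of determinant one, as an element of `SO(2N+1)`. -/
def ofMat (M : Matrix (Fin (2 * N + 1)) (Fin (2 * N + 1)) ℝ) (h : M * Mᵀ = 1) (hd : M.det = 1) :
    SOodd N :=
  ⟨⟨M, (Matrix.mem_orthogonalGroup_iff _ _).mpr (by simpa [Matrix.star_eq_conjTranspose] using h)⟩,
    hd⟩

lemma continuous_mat : Continuous (mat : SOodd N → Matrix _ _ ℝ) :=
  continuous_subtype_val.comp continuous_subtype_val

instance : BorelSpace (Matrix (Fin (2 * N + 1)) (Fin (2 * N + 1)) ℝ) :=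
  (inferInstance : BorelSpace (Fin (2 * N + 1) → Fin (2 * N + 1) → ℝ))

instance : CompactSpace (SOodd N) := by
  have hind : Topology.IsInducing (mat : SOodd N → Matrix _ _ ℝ) :=
    Topology.IsInducing.subtypeVal.comp Topology.IsInducing.subtypeVal
  refine ⟨hind.isCompact_iff.mpr ?_⟩
  have himg : (mat : SOodd N → Matrix _ _ ℝ) '' Set.univ = {M | M * Mᵀ = 1 ∧ M.det = 1} := by
    ext M
    constructor
    · rintro ⟨X, -, rfl⟩
      exact ⟨mat_mul_transpose X, det_mat X⟩
    · rintro ⟨h, hd⟩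
      exact ⟨ofMat M h hd, trivial, rfl⟩
  have hcl : IsClosed {M : Matrix (Fin (2 * N + 1)) (Fin (2 * N + 1)) ℝ |
      M * Mᵀ = 1 ∧ M.det = 1} :=
    (isClosed_eq (by fun_prop) continuous_const).inter
      (isClosed_eq (continuous_id.matrix_det) continuous_const)
  have hc : IsCompact (Set.univ.pi fun _ : Fin (2 * N + 1) =>
      Set.univ.pi fun _ : Fin (2 * N + 1) => Set.Icc (-1 : ℝ) 1) :=
    isCompact_univ_pi fun _ => isCompact_univ_pi fun _ => isCompact_Icc
  rw [himg]
  refine hc.of_isClosed_subset hcl ?_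
  rintro M ⟨h, hd⟩ i - j -
  have hb := entry_norm_bound_of_unitary (ofMat M h hd).1.2 i j
  exact abs_le.mp hb

lemma exists_fixed_vector (X : SOodd N) : ∃ v, mat X *ᵥ v = v ∧ v ⬝ᵥ v = 1 := by
  have hdet : (1 - mat X).det = 0 := by
    have h1 : ((mat X)ᵀ - 1) * mat X = 1 - mat X := by rw [sub_mul, transpose_mul_mat, one_mul]
    have h2 : ((mat X)ᵀ - 1) = -(1 - mat X)ᵀ := by simp
    have h3 := congrArg Matrix.det h1
    rw [Matrix.det_mul, det_mat, mul_one, h2, Matrix.det_neg, Matrix.det_transpose] at h3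
    simp [pow_succ, pow_mul] at h3
    linarith
  obtain ⟨v, hv, hv0⟩ := Matrix.exists_mulVec_eq_zero_iff.mpr hdet
  rw [Matrix.sub_mulVec, Matrix.one_mulVec, sub_eq_zero] at hv0
  have hpos : 0 < v ⬝ᵥ v := lt_of_le_of_ne (dotProduct_self_nonneg v)
    (fun h => hv (dotProduct_self_eq_zero.mp h.symm))
  refine ⟨(√(v ⬝ᵥ v))⁻¹ • v, by rw [Matrix.mulVec_smul, ← hv0], ?_⟩
  rw [smul_dotProduct, dotProduct_smul, smul_eq_mul, smul_eq_mul, ← mul_assoc, ← mul_inv,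
    Real.mul_self_sqrt hpos.le, inv_mul_cancel₀ hpos.ne']

lemma exp_mul_transpose_of_skew {n : Type*} [Fintype n] [DecidableEq n] {A : Matrix n n ℝ}
    (hA : Aᵀ = -A) (t : ℝ) : NormedSpace.exp (t • A) * (NormedSpace.exp (t • A))ᵀ = 1 := by
  rw [← Matrix.exp_transpose, Matrix.transpose_smul, hA, smul_neg, Matrix.exp_neg]
  exact Matrix.mul_nonsing_inv _ ((Matrix.isUnit_iff_isUnit_det _).mp (Matrix.isUnit_exp _))

lemma exp_add_smul {n : Type*} [Fintype n] [DecidableEq n] (A : Matrix n n ℝ) (t u : ℝ) :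
    NormedSpace.exp ((t + u) • A) = NormedSpace.exp (t • A) * NormedSpace.exp (u • A) := by
  rw [add_smul]
  exact Matrix.exp_add_of_commute _ _ (((Commute.refl A).smul_left t).smul_right u)

lemma det_exp_of_skew {n : Type*} [Fintype n] [DecidableEq n] {A : Matrix n n ℝ}
    (hA : Aᵀ = -A) (t : ℝ) : (NormedSpace.exp (t • A)).det = 1 := by
  have h := congrArg Matrix.det (exp_mul_transpose_of_skew hA (t / 2))
  rw [Matrix.det_mul, Matrix.det_transpose, Matrix.det_one] at h
  rw [← add_halves t, exp_add_smul, Matrix.det_mul, h]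

/-- The one-parameter subgroup of rotations generated by a skew-symmetric matrix. -/
def skewRot {A : Matrix (Fin (2 * N + 1)) (Fin (2 * N + 1)) ℝ} (hA : Aᵀ = -A) (t : ℝ) :
    SOodd N :=
  ofMat (NormedSpace.exp (t • A)) (exp_mul_transpose_of_skew hA t) (det_exp_of_skew hA t)

lemma skewRot_add {A : Matrix (Fin (2 * N + 1)) (Fin (2 * N + 1)) ℝ} (hA : Aᵀ = -A) (t u : ℝ) :
    skewRot (N := N) hA (t + u) = skewRot hA t * skewRot hA u :=
  Subtype.ext (Subtype.ext (exp_add_smul A t u))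

lemma integrable_of_continuous (μ : Measure (SOodd N)) [IsProbabilityMeasure μ] {f : SOodd N → ℝ}
    (hf : Continuous f) : Integrable f μ := by
  obtain ⟨C, hC⟩ := isCompact_univ.exists_bound_of_continuousOn hf.continuousOn
  exact Integrable.of_bound hf.aestronglyMeasurable C (ae_of_all _ fun X => hC X trivial)

lemma integral_derivative_eq_zero (μ : Measure (SOodd N)) [μ.IsHaarMeasure]
    [IsProbabilityMeasure μ] {A : Matrix (Fin (2 * N + 1)) (Fin (2 * N + 1)) ℝ} (hA : Aᵀ = -A)
    {f f' : SOodd N → ℝ} (hf : Continuous f) (hf' : Continuous f')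
    (h : ∀ X, HasDerivAt (fun t => f (skewRot hA t * X)) (f' X) 0) : ∫ X, f' X ∂μ = 0 := by
  obtain ⟨C, hC⟩ := isCompact_univ.exists_bound_of_continuousOn hf'.continuousOn
  have hder : ∀ X t, HasDerivAt (fun t => f (skewRot hA t * X)) (f' (skewRot hA t * X)) t := by
    intro X t
    have h1 : HasDerivAt (fun u => f (skewRot hA u * (skewRot hA t * X)))
        (f' (skewRot hA t * X)) (t - t) := by simpa using h (skewRot hA t * X)
    have h2 := h1.comp_sub_const t t
    refine h2.congr_of_eventuallyEq (Eventually.of_forall fun u => ?_)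
    simp only [← mul_assoc, ← skewRot_add, sub_add_cancel]
  have key := hasDerivAt_integral_of_dominated_loc_of_deriv_le (μ := μ) (𝕜 := ℝ)
    (F := fun t X => f (skewRot hA t * X)) (F' := fun t X => f' (skewRot hA t * X))
    (x₀ := 0) (s := Set.univ) (bound := fun _ => C) Filter.univ_mem
    (Eventually.of_forall fun t => (hf.comp (continuous_const_mul _)).aestronglyMeasurable)
    (integrable_of_continuous μ (hf.comp (continuous_const_mul _)))
    (hf'.comp (continuous_const_mul _)).aestronglyMeasurable
    (ae_of_all _ fun X t _ => hC _ trivial) (integrable_const _)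
    (ae_of_all _ fun X t _ => hder X t)
  have h1 := key.2
  simp only [integral_mul_left_eq_self] at h1
  exact h1.unique (hasDerivAt_const _ _)

lemma continuous_invOneSub_mat {s : ℝ} (hs : 0 ≤ s) (hs1 : s < 1) :
    Continuous fun X : SOodd N => invOneSub s (mat X) := by
  have hc : Continuous fun X : SOodd N => 1 - s • mat X :=
    continuous_const.sub (continuous_mat.const_smul s)
  simp only [invOneSub, Matrix.inv_def, Ring.inverse_eq_inv']
  exact (hc.matrix_det.inv₀ fun X =>
    (isUnit_one_sub_smul (transpose_mul_mat X) hs hs1).ne_zero).smul hc.matrix_adjugate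

end Group

section LoopEquation

variable {N : ℕ}

lemma continuous_excess_mat {s : ℝ} (hs : 0 ≤ s) (hs1 : s < 1) :
    Continuous fun X : SOodd N => excess s (mat X) :=
  (((continuous_invOneSub_mat hs hs1).matrix_trace).sub continuous_const).sub continuous_const

lemma excess_mat_nonneg {s : ℝ} (hs : 0 ≤ s) (hs1 : s < 1) (X : SOodd N) :
    0 ≤ excess s (mat X) := by
  obtain ⟨v, hv, hv1⟩ := exists_fixed_vector X
  exact excess_nonneg (transpose_mul_mat X) (mat_mul_transpose X) hs hs1 hv hv1

lemma integral_loop_generator (μ : Measure (SOodd N)) [μ.IsHaarMeasure] [IsProbabilityMeasure μ]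
    {s : ℝ} (hs : 0 ≤ s) (hs1 : s < 1) (p : ℕ)
    {A : Matrix (Fin (2 * N + 1)) (Fin (2 * N + 1)) ℝ} (hA : Aᵀ = -A) :
    Continuous (fun X : SOodd N =>
      (A * (invOneSub s (mat X) * A * (invOneSub s (mat X) - 1))).trace * excess s (mat X) ^ p +
      (p * excess s (mat X) ^ (p - 1)) * ((A * invOneSub s (mat X)).trace *
        (A * (invOneSub s (mat X) * invOneSub s (mat X) - invOneSub s (mat X))).trace)) ∧
    ∫ X, ((A * (invOneSub s (mat X) * A * (invOneSub s (mat X) - 1))).trace *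
        excess s (mat X) ^ p +
      (p * excess s (mat X) ^ (p - 1)) * ((A * invOneSub s (mat X)).trace *
        (A * (invOneSub s (mat X) * invOneSub s (mat X) - invOneSub s (mat X))).trace)) ∂μ = 0 := by
  have hQ := continuous_invOneSub_mat (N := N) hs hs1
  have hT := continuous_excess_mat (N := N) hs hs1
  have hc1 : Continuous fun X : SOodd N => (A * invOneSub s (mat X)).trace :=
    (continuous_const.matrix_mul hQ).matrix_trace
  have hc2 : Continuous fun X : SOodd N =>
      (A * (invOneSub s (mat X) * A * (invOneSub s (mat X) - 1))).trace :=
    (continuous_const.matrix_mul ((hQ.matrix_mul continuous_const).matrix_mul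
      (hQ.sub continuous_const))).matrix_trace
  have hc3 : Continuous fun X : SOodd N =>
      (A * (invOneSub s (mat X) * invOneSub s (mat X) - invOneSub s (mat X))).trace :=
    (continuous_const.matrix_mul ((hQ.matrix_mul hQ).sub hQ)).matrix_trace
  have hcont := (hc2.mul (hT.pow p)).add
    ((continuous_const.mul (hT.pow (p - 1))).mul (hc1.mul hc3) :
      Continuous fun X : SOodd N => ((p : ℝ) * excess s (mat X) ^ (p - 1)) * _)
  refine ⟨hcont, ?_⟩
  refine integral_derivative_eq_zero μ hA
    (f := fun X => (A * invOneSub s (mat X)).trace * excess s (mat X) ^ p)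
    (hc1.mul (hT.pow p)) hcont fun X => ?_
  have hd := hasDerivAt_invOneSub_exp (transpose_mul_mat X) hs hs1 A
  have hd1 : HasDerivAt
      (fun t : ℝ => (A * invOneSub s (NormedSpace.exp (t • A) * mat X)).trace)
      (A * (invOneSub s (mat X) * A * (invOneSub s (mat X) - 1))).trace 0 :=
    hd.matrix_trace_mul A
  have hd2 : HasDerivAt (fun t : ℝ => excess s (NormedSpace.exp (t • A) * mat X))
      (A * (invOneSub s (mat X) * invOneSub s (mat X) - invOneSub s (mat X))).trace 0 := by
    have h := ((HasDerivAt.matrix_trace hd).sub_const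
      ((Fintype.card (Fin (2 * N + 1)) : ℝ) / 2)).sub_const ((1 + s) / (2 * (1 - s)))
    refine h.congr_deriv ?_
    rw [mul_assoc, Matrix.trace_mul_comm, mul_assoc, sub_mul, one_mul]
  have h := hd1.mul (hd2.pow p)
  simp only [Pi.pow_apply, zero_smul, NormedSpace.exp_zero, one_mul] at h
  refine h.congr_deriv ?_
  ring

lemma integral_loop_eq (μ : Measure (SOodd N)) [μ.IsHaarMeasure] [IsProbabilityMeasure μ]
    {s : ℝ} (hs : 0 ≤ s) (hs1 : s < 1) (p : ℕ) :
    ∫ X, (((N : ℝ) ^ 2 - excess s (mat X) ^ 2 - excess s (mat X) * (2 * s / (1 - s ^ 2))) *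
        excess s (mat X) ^ p +
      (p * excess s (mat X) ^ (p - 1)) *
        (((invOneSub s (mat X))ᵀ *
            (invOneSub s (mat X) * invOneSub s (mat X) - invOneSub s (mat X))).trace -
          (invOneSub s (mat X) *
            (invOneSub s (mat X) * invOneSub s (mat X) - invOneSub s (mat X))).trace)) ∂μ = 0 := by
  have hgen := fun i j : Fin (2 * N + 1) =>
    integral_loop_generator μ hs hs1 p (skewGen_transpose i j)
  have hcoord := fun i j => integrable_of_continuous μ (hgen i j).1
  have hzero := integral_finsetSum Finset.univ
    (fun i _ => integrable_finsetSum Finset.univ (fun j _ => hcoord i j))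
  rw [Finset.sum_congr rfl fun i _ => integral_finsetSum Finset.univ fun j _ => hcoord i j] at hzero
  simp only [fun i j => (hgen i j).2, Finset.sum_const_zero] at hzero
  simp only [Finset.sum_add_distrib, ← Finset.mul_sum, ← Finset.sum_mul,
    sum_trace_skewGen_mul_mul, sum_trace_skewGen_mul_trace] at hzero
  have hpt : ∀ X : SOodd N, _ := fun X =>
    trace_loop_eq (transpose_mul_mat X) (mat_mul_transpose X) hs hs1
  simp only [hpt] at hzero
  rw [← mul_right_inj' (two_ne_zero (α := ℝ)), mul_zero, ← integral_const_mul, ← hzero]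
  congr 1
  funext X
  simp only [Fintype.card_fin]
  push_cast
  ring

lemma integral_excess_le (μ : Measure (SOodd N)) [μ.IsHaarMeasure] [IsProbabilityMeasure μ]
    {s : ℝ} (hs : 0 ≤ s) (hs1 : s < 1) (p : ℕ) :
    ∫ X, excess s (mat X) ^ (p + 2) ∂μ + 2 * s / (1 - s ^ 2) * ∫ X, excess s (mat X) ^ (p + 1) ∂μ ≤
      ((N : ℝ) ^ 2 + p * (4 / (1 - s) ^ 2)) * ∫ X, excess s (mat X) ^ p ∂μ := by
  have hT := continuous_excess_mat (N := N) hs hs1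
  have hi : ∀ q : ℕ, Integrable (fun X : SOodd N => excess s (mat X) ^ q) μ := fun q =>
    integrable_of_continuous μ (hT.pow q)
  have hQ := continuous_invOneSub_mat (N := N) hs hs1
  have hadd : Integrable (fun X : SOodd N => excess s (mat X) ^ (p + 2) +
      2 * s / (1 - s ^ 2) * excess s (mat X) ^ (p + 1)) μ := (hi _).add ((hi _).const_mul _)
  rw [← integral_const_mul, ← integral_const_mul,
    ← integral_add (hi _) ((hi _).const_mul _), ← sub_nonneg,
    ← integral_sub ((hi _).const_mul _) hadd, ← integral_loop_eq μ hs hs1 p]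
  refine integral_mono (integrable_of_continuous μ ?_) (((hi _).const_mul _).sub hadd) fun X => ?_
  · refine Continuous.add (Continuous.mul (by fun_prop) (hT.pow p)) (Continuous.mul (by fun_prop) ?_)
    exact ((hQ.matrix_transpose.matrix_mul ((hQ.matrix_mul hQ).sub hQ)).matrix_trace).sub
      ((hQ.matrix_mul ((hQ.matrix_mul hQ).sub hQ)).matrix_trace)
  · obtain ⟨v, hv, hv1⟩ := exists_fixed_vector X
    have h0 := excess_mat_nonneg hs hs1 X
    have hW := trace_cubic_le (transpose_mul_mat X) (mat_mul_transpose X) hs hs1 hv hv1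
    have h1 := mul_le_mul_of_nonneg_left hW
      (by positivity : 0 ≤ (p : ℝ) * excess s (mat X) ^ (p - 1))
    have h2 : (p : ℝ) * excess s (mat X) ^ (p - 1) * (4 / (1 - s) ^ 2 * excess s (mat X)) =
        p * (4 / (1 - s) ^ 2) * excess s (mat X) ^ p := by
      rcases p with _ | p
      · simp
      · rw [Nat.add_sub_cancel, pow_succ]; ring
    rw [h2] at h1
    refine (add_le_add_right h1 _).trans (le_of_eq ?_)
    ring

end LoopEquation

section LogDeriv

variable {N : ℕ}

lemma hasDerivAt_det_one_sub_smul {n : Type*} [Fintype n] [DecidableEq n] {Y : Matrix n n ℝ}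
    {s : ℝ} (hu : IsUnit (1 - s • Y).det) :
    HasDerivAt (fun t : ℝ => (1 - t • Y).det)
      (-((1 - s • Y).det * (invOneSub s Y * Y).trace)) s := by
  have h1 : ∀ t : ℝ, (1 - t • Y).det =
      (1 - s • Y).det * (1 + (t - s) • (-(invOneSub s Y * Y))).det := by
    intro t
    rw [← Matrix.det_mul, mul_add, mul_one, mul_smul_comm, mul_neg, ← mul_assoc, invOneSub,
      Matrix.mul_nonsing_inv _ hu, one_mul]
    congr 1
    module
  have h2 : HasDerivAt (fun t : ℝ => (1 + t • (-(invOneSub s Y * Y))).det)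
      (-(invOneSub s Y * Y)).trace (s - s) := by
    have hP := fun t : ℝ => Matrix.det_one_add_smul t (-(invOneSub s Y * Y))
    generalize (1 + (Polynomial.X : Polynomial ℝ) •
      (-(invOneSub s Y * Y)).map Polynomial.C).det.divX.divX = P at hP
    rw [sub_self, funext hP]
    have h := ((((hasDerivAt_id (0 : ℝ)).const_mul (-(invOneSub s Y * Y)).trace).const_add 1)).add
      ((P.hasDerivAt 0).mul ((hasDerivAt_id (0 : ℝ)).pow 2))
    refine h.congr_deriv ?_
    simp
  have h3 := (h2.comp_sub_const s s).const_mul (1 - s • Y).det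
  refine (h3.congr_of_eventuallyEq (Eventually.of_forall h1)).congr_deriv ?_
  rw [Matrix.trace_neg]; ring

lemma logDeriv_charPoly {s : ℝ} (hs : 0 < s) (hs1 : s < 1) (X : SOodd N) :
    logDeriv (charPoly X) s = -(1 / (1 - s) - (N - excess s (mat X)) / s) := by
  have hY : (mat X)ᵀᵀ * (mat X)ᵀ = 1 := by simpa using mat_mul_transpose X
  have hu := isUnit_one_sub_smul hY hs.le hs1
  have hd := hasDerivAt_det_one_sub_smul hu
  have h1 : logDeriv (charPoly X) s = -(invOneSub s (mat X)ᵀ * (mat X)ᵀ).trace := by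
    rw [logDeriv_apply, show charPoly X = fun t : ℝ => (1 - t • (mat X)ᵀ).det from rfl, hd.deriv,
      neg_div, mul_div_cancel_left₀ _ hu.ne_zero]
  have h2 := congrArg Matrix.trace (smul_mul_invOneSub (transpose_mul_mat X) hs.le hs1)
  rw [Matrix.trace_smul, Matrix.trace_sub, Matrix.trace_one, smul_eq_mul] at h2
  have h3 : (invOneSub s (mat X)ᵀ * (mat X)ᵀ).trace = (mat X * invOneSub s (mat X)).trace := by
    rw [invOneSub_transpose, ← Matrix.transpose_mul, Matrix.trace_transpose]
  have h4 : (invOneSub s (mat X)).trace =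
      excess s (mat X) + (2 * N + 1) / 2 + (1 + s) / (2 * (1 - s)) := by
    rw [excess, Fintype.card_fin]; push_cast; ring
  rw [h4, Fintype.card_fin] at h2
  rw [h1, h3]
  have hd1 : 1 - s ≠ 0 := by linarith
  push_cast at h2
  have h5 : (mat X * invOneSub s (mat X)).trace =
    (excess s (mat X) + (2 * N + 1) / 2 + (1 + s) / (2 * (1 - s)) - (2 * N + 1)) / s := by
    rw [← h2]; field_simp
  rw [h5]
  field_simp
  ring

end LogDeriv

section Asymptotics

lemma exists_abs_add_pow_sub_le (m : ℕ) : ∃ C : ℝ, 0 ≤ C ∧ ∀ u r : ℝ, 0 ≤ u →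
    |(u + r) ^ (m + 2) - u ^ (m + 2) - (m + 2) * u ^ (m + 1) * r| ≤
      C * (u ^ m * r ^ 2 + |r| ^ (m + 2)) := by
  induction m with
  | zero =>
    refine ⟨1, zero_le_one, fun u r _ => ?_⟩
    have h : (u + r) ^ (0 + 2) - u ^ (0 + 2) - ((0 : ℕ) + 2) * u ^ (0 + 1) * r = r ^ 2 := by
      push_cast; ring
    rw [h, abs_of_nonneg (sq_nonneg r), zero_add, sq_abs]
    nlinarith [sq_nonneg r]
  | succ m ih =>
    obtain ⟨C, hC, h⟩ := ih
    refine ⟨3 * C + (m + 2), by positivity, fun u r hu => ?_⟩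
    have hD := h u r hu
    set D := (u + r) ^ (m + 2) - u ^ (m + 2) - (m + 2) * u ^ (m + 1) * r with hDdef
    have hrec : (u + r) ^ (m + 1 + 2) - u ^ (m + 1 + 2) -
        ((m + 1 : ℕ) + 2) * u ^ (m + 1 + 1) * r = (u + r) * D + (m + 2) * u ^ (m + 1) * r ^ 2 := by
      rw [hDdef]; push_cast; ring
    have hv : 0 ≤ |r| := abs_nonneg r
    rw [hrec, ← sq_abs r]
    rw [← sq_abs r] at hD
    have h1 : |(u + r) * D| ≤ (u + |r|) * (C * (u ^ m * |r| ^ 2 + |r| ^ (m + 2))) := by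
      rw [abs_mul]
      refine mul_le_mul ?_ hD (abs_nonneg _) (by positivity)
      exact (abs_add_le u r).trans_eq (by rw [abs_of_nonneg hu])
    have h2 : |(m + 2) * u ^ (m + 1) * |r| ^ 2| = (m + 2) * u ^ (m + 1) * |r| ^ 2 :=
      abs_of_nonneg (by positivity)
    generalize |r| = v at *
    have hcross : u * v ^ (m + 2) ≤ u ^ (m + 1) * v ^ 2 + v ^ (m + 3) ∧
        u ^ m * v ^ 3 ≤ u ^ (m + 1) * v ^ 2 + v ^ (m + 3) := by
      have e1 : 0 ≤ u ^ (m + 1) * v ^ 2 := by positivity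
      have e2 : 0 ≤ v ^ (m + 3) := by positivity
      rcases le_total v u with huv | huv
      · have hp := pow_le_pow_left₀ hv huv m
        have e3 := mul_le_mul_of_nonneg_left hp (by positivity : 0 ≤ u * v ^ 2)
        have e4 := mul_le_mul_of_nonneg_left huv (by positivity : 0 ≤ u ^ m * v ^ 2)
        constructor <;> ring_nf at * <;> linarith
      · have hp := pow_le_pow_left₀ hu huv m
        have e3 := mul_le_mul_of_nonneg_left hp (by positivity : 0 ≤ v ^ 3)
        have e4 := mul_le_mul_of_nonneg_left huv (by positivity : 0 ≤ v ^ (m + 2))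
        constructor <;> ring_nf at * <;> linarith
    have h3 := mul_le_mul_of_nonneg_left (add_le_add hcross.1 hcross.2) hC
    have h4 : 0 ≤ ((m : ℝ) + 2) * v ^ (m + 3) := by positivity
    refine (abs_add_le _ _).trans ?_
    rw [h2]
    refine (add_le_add_left h1 _).trans ?_
    have e : m + 1 + 2 = m + 3 := rfl
    rw [e]
    ring_nf at *
    linarith

lemma exp_neg_bounds {x : ℝ} (hx : 0 < x) (hx2 : x ≤ 1 / 2) :
    1 / 2 ≤ rexp (-x) ∧ rexp (-x) < 1 ∧ 1 - rexp (-x) ≤ x ∧ x / 2 ≤ 1 - rexp (-x) ∧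
      0 ≤ 1 / (1 - rexp (-x)) - 1 / x ∧ 1 / (1 - rexp (-x)) - 1 / x ≤ 1 := by
  have h1 := Real.add_one_le_exp (-x)
  have h2 := Real.add_one_le_exp x
  have h3 : rexp (-x) * rexp x = 1 := by rw [← Real.exp_add]; simp
  have h4 := Real.exp_pos (-x)
  generalize rexp (-x) = s at *
  have h5 : s * (x + 1) ≤ 1 := by nlinarith
  have h6 : s < 1 := by nlinarith
  have h7 : 0 < 1 - s := by linarith
  refine ⟨by linarith, h6, by linarith, by nlinarith, ?_, ?_⟩
  · rw [sub_nonneg]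
    exact one_div_le_one_div_of_le h7 (by linarith)
  · rw [sub_le_iff_le_add, div_le_iff₀ h7]
    have : (1 + 1 / x) * (1 - s) * x = (x + 1) * (1 - s) := by field_simp
    nlinarith

lemma integral_excess_le_two_mul {N : ℕ} (hN : 1 ≤ N) (μ : Measure (SOodd N)) [μ.IsHaarMeasure]
    [IsProbabilityMeasure μ] {s a : ℝ} (hs : 1 / 2 ≤ s) (hs1 : s < 1) (h1 : 1 - s ≤ a / N) :
    ∫ X, excess s (mat X) ∂μ ≤ 2 * N * a := by
  have hs0 : 0 ≤ s := by linarith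
  have h := integral_excess_le μ hs0 hs1 0
  have hT2 : 0 ≤ ∫ X, excess s (mat X) ^ (0 + 2) ∂μ :=
    integral_nonneg fun X => pow_nonneg (excess_mat_nonneg hs0 hs1 X) _
  have hT1 : 0 ≤ ∫ X, excess s (mat X) ∂μ :=
    integral_nonneg fun X => excess_mat_nonneg hs0 hs1 X
  simp only [zero_add, pow_one, pow_zero, integral_const, probReal_univ, smul_eq_mul, mul_one,
    Nat.cast_zero, zero_mul, add_zero] at h hT2
  have hd : 0 < 1 - s ^ 2 := by nlinarith
  have hN0 : (0 : ℝ) < N := by exact_mod_cast hN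
  have h2 : 2 * s / (1 - s ^ 2) * ∫ X, excess s (mat X) ∂μ ≤ (N : ℝ) ^ 2 := by linarith
  rw [div_mul_eq_mul_div, div_le_iff₀ hd] at h2
  rw [le_div_iff₀ hN0] at h1
  generalize ∫ X, excess s (mat X) ∂μ = I at *
  have h3 : I ≤ 2 * s * I := by nlinarith
  have h4 : (N : ℝ) ^ 2 * (1 - s ^ 2) ≤ 2 * N * ((1 - s) * N) := by
    have : 1 - s ^ 2 ≤ 2 * (1 - s) := by nlinarith
    nlinarith [mul_le_mul_of_nonneg_left this (sq_nonneg (N : ℝ))]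
  have h5 := mul_le_mul_of_nonneg_left h1 (by positivity : (0 : ℝ) ≤ 2 * N)
  linarith

lemma integral_excess_pow_add_two_le {N : ℕ} (hN : 1 ≤ N) (μ : Measure (SOodd N))
    [μ.IsHaarMeasure] [IsProbabilityMeasure μ] {s a : ℝ} (hs : 1 / 2 ≤ s) (hs1 : s < 1)
    (ha : 0 < a) (ha1 : a ≤ 1) (h2 : a / N / 2 ≤ 1 - s) (p : ℕ) :
    ∫ X, excess s (mat X) ^ (p + 2) ∂μ ≤
      (1 + 16 * p) * (N / a) ^ 2 * ∫ X, excess s (mat X) ^ p ∂μ := by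
  have hs0 : 0 ≤ s := by linarith
  have hT : ∀ q : ℕ, 0 ≤ ∫ X, excess s (mat X) ^ q ∂μ := fun q =>
    integral_nonneg fun X => pow_nonneg (excess_mat_nonneg hs0 hs1 X) _
  have h := integral_excess_le μ hs0 hs1 p
  have hd : 0 < 1 - s ^ 2 := by nlinarith
  have hN0 : (0 : ℝ) < N := by exact_mod_cast hN
  have hc : 0 ≤ 2 * s / (1 - s ^ 2) := by positivity
  have hc1 := mul_nonneg hc (hT (p + 1))
  refine ((le_add_of_nonneg_right hc1).trans h).trans (mul_le_mul_of_nonneg_right ?_ (hT p))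
  have e1 : (N : ℝ) ≤ N / a := (le_div_iff₀ ha).2 (by nlinarith)
  have e2 : (N : ℝ) ^ 2 ≤ (N / a) ^ 2 := pow_le_pow_left₀ hN0.le e1 2
  have e3 : 4 / (1 - s) ^ 2 ≤ 16 * (N / a) ^ 2 := by
    have : 4 / (1 - s) ^ 2 ≤ 4 / (a / N / 2) ^ 2 := by gcongr
    refine this.trans_eq ?_
    field_simp
    norm_num
  nlinarith [mul_le_mul_of_nonneg_left e3 (Nat.cast_nonneg (α := ℝ) p)]

lemma exists_integral_excess_pow_le (k : ℕ) : ∃ C : ℝ, 0 ≤ C ∧ ∀ {N : ℕ}, 1 ≤ N →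
    ∀ (μ : Measure (SOodd N)) [μ.IsHaarMeasure] [IsProbabilityMeasure μ] {s a : ℝ},
    1 / 2 ≤ s → s < 1 → 0 < a → a ≤ 1 → 1 - s ≤ a / N → a / N / 2 ≤ 1 - s →
    ∫ X, excess s (mat X) ^ (k + 2) ∂μ ≤ C * ((N : ℝ) ^ 2 * (N / a) ^ k) := by
  induction k using Nat.twoStepInduction with
  | zero =>
    refine ⟨1, zero_le_one, fun {N} hN μ _ _ {s a} hs hs1 ha ha1 h1 h2 => ?_⟩
    have hs0 : 0 ≤ s := by linarith
    have h := integral_excess_le μ hs0 hs1 0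
    have hT1 : 0 ≤ ∫ X, excess s (mat X) ∂μ :=
      integral_nonneg fun X => excess_mat_nonneg hs0 hs1 X
    have hd : 0 < 1 - s ^ 2 := by nlinarith
    have hc : 0 ≤ 2 * s / (1 - s ^ 2) := by positivity
    have hc1 := mul_nonneg hc hT1
    simp only [zero_add, pow_one, pow_zero, integral_const, probReal_univ, smul_eq_mul, mul_one,
      Nat.cast_zero, zero_mul, add_zero, one_mul] at h ⊢
    linarith
  | one =>
    refine ⟨34, by norm_num, fun {N} hN μ _ _ {s a} hs hs1 ha ha1 h1 h2 => ?_⟩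
    have h := integral_excess_pow_add_two_le hN μ hs hs1 ha ha1 h2 1
    have h' := integral_excess_le_two_mul hN μ hs hs1 h1
    simp only [pow_one, Nat.cast_one, mul_one] at h ⊢
    refine h.trans ((mul_le_mul_of_nonneg_left h' (by positivity)).trans_eq ?_)
    field_simp
    norm_num
  | more k ih _ =>
    obtain ⟨C, hC, ih⟩ := ih
    refine ⟨(1 + 16 * ((k + 2 : ℕ) : ℝ)) * C, by positivity,
      fun {N} hN μ _ _ {s a} hs hs1 ha ha1 h1 h2 => ?_⟩
    have h := integral_excess_pow_add_two_le hN μ hs hs1 ha ha1 h2 (k + 2)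
    refine h.trans ((mul_le_mul_of_nonneg_left (ih hN μ hs hs1 ha ha1 h1 h2)
      (by positivity)).trans_eq ?_)
    ring

lemma exists_integral_remainder_pow_le (k : ℕ) : ∃ C : ℝ, 0 ≤ C ∧ ∀ {N : ℕ}, 1 ≤ N →
    ∀ (μ : Measure (SOodd N)) [μ.IsHaarMeasure] [IsProbabilityMeasure μ] {s a e : ℝ},
    1 / 2 ≤ s → s < 1 → 0 < a → a ≤ 1 → 1 - s ≤ a / N → a / N / 2 ≤ 1 - s → 0 ≤ e → e ≤ 1 →
    ∫ X, |e - (N - excess s (mat X)) / s| ^ (k + 2) ∂μ ≤ C * ((N : ℝ) ^ 2 * (N / a) ^ k) := by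
  obtain ⟨B, hB, hmom⟩ := exists_integral_excess_pow_le k
  refine ⟨2 ^ (k + 1) * (3 ^ (k + 2) + 2 ^ (k + 2) * B), by positivity,
    fun {N} hN μ _ _ {s a e} hs hs1 ha ha1 h1 h2 he he1 => ?_⟩
  have hs0 : 0 ≤ s := by linarith
  have hspos : 0 < s := by linarith
  have hN1 : (1 : ℝ) ≤ N := by exact_mod_cast hN
  have hT := continuous_excess_mat (N := N) hs0 hs1
  have hi : Integrable (fun X : SOodd N => excess s (mat X) ^ (k + 2)) μ :=
    integrable_of_continuous μ (hT.pow _)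
  have hpt : ∀ X : SOodd N, |e - (N - excess s (mat X)) / s| ^ (k + 2) ≤
      2 ^ (k + 1) * ((3 * N) ^ (k + 2) + 2 ^ (k + 2) * excess s (mat X) ^ (k + 2)) := by
    intro X
    have h0 := excess_mat_nonneg hs0 hs1 X
    generalize excess s (mat X) = T at *
    have hr : |e - (N - T) / s| ≤ 3 * N + 2 * T := by
      have e1 : (N - T) / s ≤ 2 * N := (div_le_iff₀ hspos).2 (by nlinarith)
      have e2 : -(2 * T) ≤ (N - T) / s := (le_div_iff₀ hspos).2 (by nlinarith)
      rw [abs_le]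
      constructor <;> linarith
    refine (pow_le_pow_left₀ (abs_nonneg _) hr _).trans ?_
    have := add_pow_le (by positivity : (0 : ℝ) ≤ 3 * N) (by positivity : 0 ≤ 2 * T) (k + 2)
    rwa [mul_pow 2 T] at this
  have hu : (N : ℝ) ^ k ≤ (N / a) ^ k :=
    pow_le_pow_left₀ (by positivity) ((le_div_iff₀ ha).2 (by nlinarith)) k
  calc ∫ X, |e - (N - excess s (mat X)) / s| ^ (k + 2) ∂μ
      ≤ ∫ X, 2 ^ (k + 1) * ((3 * N) ^ (k + 2) + 2 ^ (k + 2) * excess s (mat X) ^ (k + 2)) ∂μ := by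
        refine integral_mono (integrable_of_continuous μ ?_) (integrable_of_continuous μ ?_) hpt
        all_goals fun_prop
    _ = 2 ^ (k + 1) * (3 ^ (k + 2) * ((N : ℝ) ^ 2 * N ^ k) +
          2 ^ (k + 2) * ∫ X, excess s (mat X) ^ (k + 2) ∂μ) := by
        rw [integral_const_mul, integral_add (integrable_const _) (hi.const_mul _),
          integral_const_mul, integral_const, probReal_univ, one_smul]
        ring
    _ ≤ 2 ^ (k + 1) * (3 ^ (k + 2) * ((N : ℝ) ^ 2 * (N / a) ^ k) +
          2 ^ (k + 2) * (B * ((N : ℝ) ^ 2 * (N / a) ^ k))) := by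
        gcongr
        exact hmom hN μ hs hs1 ha ha1 h1 h2
    _ = _ := by ring

lemma abs_integral_remainder_add_le {N : ℕ} (hN : 1 ≤ N) (μ : Measure (SOodd N))
    [μ.IsHaarMeasure] [IsProbabilityMeasure μ] {s a e : ℝ} (hs : 1 / 2 ≤ s) (hs1 : s < 1)
    (ha1 : a ≤ 1) (h1 : 1 - s ≤ a / N) (he : 0 ≤ e) (he1 : e ≤ 1) :
    |∫ X, (e - (N - excess s (mat X)) / s) ∂μ + N| ≤ 4 * (1 + N * a) := by
  have hs0 : 0 ≤ s := by linarith
  have hspos : 0 < s := by linarith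
  have hN0 : (0 : ℝ) < N := by exact_mod_cast hN
  have hT := continuous_excess_mat (N := N) hs0 hs1
  have hi : Integrable (fun X : SOodd N => excess s (mat X)) μ := integrable_of_continuous μ hT
  have hI := integral_excess_le_two_mul hN μ hs hs1 h1
  have hI0 : 0 ≤ ∫ X, excess s (mat X) ∂μ :=
    integral_nonneg fun X => excess_mat_nonneg hs0 hs1 X
  have hdiv : Integrable (fun X : SOodd N => (N - excess s (mat X)) / s) μ :=
    integrable_of_continuous μ (by fun_prop)
  have hcoord : ∫ X, (e - (N - excess s (mat X)) / s) ∂μ =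
      e - (N - ∫ X, excess s (mat X) ∂μ) / s := by
    rw [integral_sub (integrable_const _) hdiv, integral_div,
      integral_sub (integrable_const _) hi]
    simp
  rw [hcoord]
  generalize ∫ X, excess s (mat X) ∂μ = I at *
  rw [le_div_iff₀ hN0] at h1
  have e1 : e - (N - I) / s + N = e - (1 - s) * N / s + I / s := by field_simp; ring
  have e2 : (1 - s) * N / s ≤ 2 * a := (div_le_iff₀ hspos).2 (by nlinarith)
  have e3 : 0 ≤ (1 - s) * N / s := div_nonneg (by nlinarith) hs0
  have e4 : I / s ≤ 2 * I := (div_le_iff₀ hspos).2 (by nlinarith)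
  have e5 : 0 ≤ I / s := by positivity
  have e6 : 0 ≤ (N : ℝ) * a := by nlinarith
  rw [e1, abs_le]
  constructor <;> nlinarith

/-- The moment asymptotics for a single `N`, uniformly in `N` and `a`. -/
lemma exists_abs_integral_logDeriv_pow_sub_le (k : ℕ) : ∃ C : ℝ, 0 < C ∧ ∀ {N : ℕ}, 1 ≤ N →
    ∀ (μ : Measure (SOodd N)) [μ.IsHaarMeasure] [IsProbabilityMeasure μ] {a : ℝ},
    0 < a → a ≤ 1 / 2 →
    |∫ X, logDeriv (charPoly X) (rexp (-(a / N))) ^ (k + 1) ∂μ -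
        (-1) ^ (k + 1) * ((N / a) ^ (k + 1) - (k + 1) * ((N / a) ^ k * N))| ≤
      C * ((N / a) ^ k * (1 + N * a)) := by
  have hexp : ∃ C : ℝ, 0 < C ∧ ∀ {N : ℕ}, 1 ≤ N →
      ∀ (μ : Measure (SOodd N)) [μ.IsHaarMeasure] [IsProbabilityMeasure μ] {s a e : ℝ},
      1 / 2 ≤ s → s < 1 → 0 < a → a ≤ 1 → 1 - s ≤ a / N → a / N / 2 ≤ 1 - s → 0 ≤ e → e ≤ 1 →
      ∫ X, |(N / a + (e - (N - excess s (mat X)) / s)) ^ (k + 1) - (N / a) ^ (k + 1) -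
        (k + 1) * (N / a) ^ k * (e - (N - excess s (mat X)) / s)| ∂μ ≤
      C * ((N / a) ^ k * (1 + N * a)) := by
    rcases k with _ | m
    · refine ⟨1, one_pos, fun {N} hN μ _ _ {s a e} hs hs1 ha ha1 h1 h2 he he1 => ?_⟩
      have hz : ∀ x r : ℝ, |(x + r) ^ (0 + 1) - x ^ (0 + 1) - ((0 : ℕ) + 1) * x ^ 0 * r| = 0 :=
        fun x r => by simp
      simp only [hz, integral_zero]
      positivity
    obtain ⟨A, hA, hpoly⟩ := exists_abs_add_pow_sub_le m
    obtain ⟨B, hB, hB2⟩ := exists_integral_remainder_pow_le 0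
    obtain ⟨D, hD, hD2⟩ := exists_integral_remainder_pow_le m
    refine ⟨A * (B + D) + 1, by positivity,
      fun {N} hN μ _ _ {s a e} hs hs1 ha ha1 h1 h2 he he1 => ?_⟩
    have hB3 := hB2 hN μ hs hs1 ha ha1 h1 h2 he he1
    have hD3 := hD2 hN μ hs hs1 ha ha1 h1 h2 he he1
    have hs0 : 0 ≤ s := by linarith
    have hN0 : (0 : ℝ) < N := by exact_mod_cast hN
    have hT := continuous_excess_mat (N := N) hs0 hs1
    have hi : ∀ q : ℕ, Integrable (fun X : SOodd N => |e - (N - excess s (mat X)) / s| ^ q) μ :=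
      fun q => integrable_of_continuous μ (by fun_prop)
    set u : ℝ := N / a with hu
    have hu0 : 0 < u := by positivity
    have hNu : (N : ℝ) = u * a := by rw [hu]; field_simp
    calc _ ≤ ∫ X, A * (u ^ m * |e - (N - excess s (mat X)) / s| ^ (0 + 2) +
            |e - (N - excess s (mat X)) / s| ^ (m + 2)) ∂μ := by
          refine integral_mono (integrable_of_continuous μ (by fun_prop))
            (integrable_of_continuous μ (by fun_prop)) fun X => ?_
          have h := hpoly u (e - (N - excess s (mat X)) / s) hu0.le
          rw [← sq_abs (e - (N - excess s (mat X)) / s)] at h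
          refine (le_of_eq ?_).trans h
          push_cast
          ring_nf
      _ = A * (u ^ m * ∫ X, |e - (N - excess s (mat X)) / s| ^ (0 + 2) ∂μ +
            ∫ X, |e - (N - excess s (mat X)) / s| ^ (m + 2) ∂μ) := by
          rw [integral_const_mul, integral_add ((hi _).const_mul _) (hi _), integral_const_mul]
      _ ≤ A * (u ^ m * (B * ((N : ℝ) ^ 2 * u ^ 0)) + D * ((N : ℝ) ^ 2 * u ^ m)) := by gcongr
      _ = A * (B + D) * (u ^ (m + 1) * (N * a)) := by
          rw [hNu]; ring
      _ ≤ (A * (B + D) + 1) * (u ^ (m + 1) * (1 + N * a)) := by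
          have : 0 ≤ (N : ℝ) * a := by positivity
          gcongr <;> linarith
  obtain ⟨A, hA, hA2⟩ := hexp
  refine ⟨A + (k + 1) * 4, by positivity, fun {N} hN μ _ _ {a} ha ha2 => ?_⟩
  have hN1 : (1 : ℝ) ≤ N := by exact_mod_cast hN
  have hN0 : (0 : ℝ) < N := by linarith
  have hx : 0 < a / N := by positivity
  have hx2 : a / N ≤ 1 / 2 := (div_le_self ha.le hN1).trans ha2
  obtain ⟨hs, hs1, h1, h2, he, he1⟩ := exp_neg_bounds hx hx2
  generalize rexp (-(a / N)) = s at *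
  have hs0 : 0 ≤ s := by linarith
  have ha1 : a ≤ 1 := by linarith
  set e := 1 / (1 - s) - 1 / (a / N) with hedef
  have hlog : ∀ X : SOodd N, logDeriv (charPoly X) s =
      -(N / a + (e - (N - excess s (mat X)) / s)) := by
    intro X
    rw [logDeriv_charPoly (by linarith) hs1, hedef, one_div_div]
    ring
  have hA3 := hA2 hN μ hs hs1 ha ha1 h1 h2 he he1
  have hrem := abs_integral_remainder_add_le hN μ hs hs1 ha1 h1 he he1
  have hT := continuous_excess_mat (N := N) hs0 hs1
  set u : ℝ := N / a with hu
  have hu0 : 0 < u := by positivity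
  set r : SOodd N → ℝ := fun X => e - (N - excess s (mat X)) / s with hr
  have hrc : Continuous r := by rw [hr]; fun_prop
  have hri : Integrable r μ := integrable_of_continuous μ hrc
  have hpi : Integrable (fun X => (u + r X) ^ (k + 1)) μ :=
    integrable_of_continuous μ (by fun_prop)
  have hpi2 : Integrable (fun X => (u + r X) ^ (k + 1) - u ^ (k + 1)) μ :=
    integrable_of_continuous μ (by fun_prop)
  have hsplit : ∫ X, (u + r X) ^ (k + 1) ∂μ - (u ^ (k + 1) - (k + 1) * (u ^ k * N)) =
      ∫ X, ((u + r X) ^ (k + 1) - u ^ (k + 1) - (k + 1) * u ^ k * r X) ∂μ +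
        (k + 1) * u ^ k * (∫ X, r X ∂μ + N) := by
    rw [integral_sub hpi2 (hri.const_mul _),
      integral_sub hpi (integrable_const _), integral_const_mul, integral_const, probReal_univ,
      one_smul]
    ring
  have hneg : ∀ X : SOodd N, logDeriv (charPoly X) s ^ (k + 1) =
      (-1) ^ (k + 1) * (u + r X) ^ (k + 1) := fun X => by
    rw [hlog X, neg_eq_neg_one_mul, mul_pow]
  simp only [hneg]
  rw [integral_const_mul, ← mul_sub, abs_mul, abs_pow, abs_neg, abs_one, one_pow, one_mul, hsplit]
  refine (abs_add_le _ _).trans ?_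
  rw [add_mul A]
  refine add_le_add (abs_integral_le_integral_abs.trans hA3) ?_
  rw [abs_mul, abs_of_pos (by positivity : (0 : ℝ) < (k + 1) * u ^ k)]
  refine (mul_le_mul_of_nonneg_left hrem (by positivity)).trans_eq ?_
  ring

end Asymptotics

/-- Asymptotics of the integer moments of the logarithmic derivative of characteristic
polynomials over `SO(2N+1)` (Alvarez–Snaith). -/
theorem integer_moments_logDeriv_SOodd
    (K : ℕ) (hK : 0 < K)
    (a : ℕ → ℝ) (hapos : ∀ N : ℕ, 1 ≤ N → 0 < a N)
    (halim : Tendsto a atTop (nhds 0))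
    (μ : (N : ℕ) → Measure (SOodd N))
    (hμHaar : ∀ N : ℕ, (μ N).IsHaarMeasure)
    (hμProb : ∀ N : ℕ, IsProbabilityMeasure (μ N)) :
    ∃ C : ℝ, 0 < C ∧ ∃ N₀ : ℕ, ∀ N : ℕ, N₀ ≤ N →
      |(∫ X, (logDeriv (charPoly X) (Real.exp (-(a N) / N))) ^ K ∂(μ N)) -
          (-1 : ℝ) ^ K * (((N : ℝ) / a N) ^ K - K * (N : ℝ) ^ K / a N ^ ((K : ℤ) - 1))| ≤
        C * ((N : ℝ) ^ ((K : ℤ) - 1) / a N ^ ((K : ℤ) - 1) +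
          (N : ℝ) ^ (K : ℤ) / a N ^ ((K : ℤ) - 2)) := by
  obtain ⟨k, rfl⟩ : ∃ k, K = k + 1 := ⟨K - 1, by omega⟩
  obtain ⟨C, hC, hbound⟩ := exists_abs_integral_logDeriv_pow_sub_le k
  obtain ⟨N₁, hN₁⟩ := eventually_atTop.1 (halim.eventually_le_const (by norm_num : (0 : ℝ) < 1 / 2))
  refine ⟨C, hC, max N₁ 1, fun N hN => ?_⟩
  have hN1 : 1 ≤ N := (le_max_right _ _).trans hN
  have ha := hapos N hN1
  have := hμHaar N
  have := hμProb N
  have hN0 : (N : ℝ) ≠ 0 := by positivity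
  have ha0 : a N ≠ 0 := ha.ne'
  have h := hbound hN1 (μ N) ha (hN₁ N ((le_max_left _ _).trans hN))
  have e1 : ((k + 1 : ℕ) : ℤ) - 1 = (k : ℤ) := by push_cast; ring
  have e2 : a N ^ (((k + 1 : ℕ) : ℤ) - 2) = a N ^ k / a N := by
    rw [show ((k + 1 : ℕ) : ℤ) - 2 = (k : ℤ) - 1 by push_cast; ring, zpow_sub_one₀ ha0,
      zpow_natCast, div_eq_mul_inv]
  rw [e2, e1, zpow_natCast, zpow_natCast, zpow_natCast, neg_div]
  convert h using 2
  · congr 3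
    push_cast
    rw [div_pow, pow_succ (N : ℝ) k]
    ring
  · rw [div_pow]
    field_simp
    ring
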